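/- arXiv:math/0609671 — 6 statements merged into one kernel-verified Lean document; each statement's English description precedes it below -/
import Mathlib

section
/- Let a, b be positive integers such that a·b is a perfect square, say a·b = k² with k a natural number, and let c be a nonzero integer. Then the set of integer solutions (x, y) of the equation a·x² − b·y² + c = 0 is finite. -/
theorem stmt_0 (a b : ℕ) (ha : 0 < a) (hb : 0 < b) (k : ℕ) (hk : a * b = k ^ 2)
    (c : ℤ) (hc : c ≠ 0) :
    {p : ℤ × ℤ | (a : ℤ) * p.1 ^ 2 - (b : ℤ) * p.2 ^ 2 + c = 0}.Finite := by
  have ha' : (a : ℤ) ≠ 0 := by exact_mod_cast ha.ne'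
  have hk' : (a : ℤ) * b = (k : ℤ) ^ 2 := by exact_mod_cast hk
  have hk0 : (k : ℤ) ≠ 0 := by
    intro h
    have hpos : (0 : ℤ) < a * b := by positivity
    rw [hk', h] at hpos
    norm_num at hpos
  have hN : -((a : ℤ) * c) ≠ 0 := neg_ne_zero.mpr (mul_ne_zero ha' hc)
  have hfin : {d : ℤ | d ∣ -((a : ℤ) * c)}.Finite := by
    refine (Set.finite_Icc (-|-((a : ℤ) * c)|) |-((a : ℤ) * c)|).subset fun d hd => ?_
    have hle : |d| ≤ |-((a : ℤ) * c)| :=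
      Int.le_of_dvd (abs_pos.mpr hN) ((abs_dvd_abs _ _).mpr hd)
    exact abs_le.mp hle
  refine Set.Finite.of_injOn (f := fun p : ℤ × ℤ => (a * p.1 - k * p.2, a * p.1 + k * p.2))
    ?_ ?_ (hfin.prod hfin)
  · rintro ⟨x, y⟩ h
    simp only [Set.mem_ofPred_eq] at h
    have hfactor : (a * x - k * y) * (a * x + k * y) = -((a : ℤ) * c) := by
      linear_combination (a : ℤ) * h + y ^ 2 * hk'
    exact ⟨Dvd.intro _ hfactor, Dvd.intro_left _ hfactor⟩
  · rintro ⟨x, y⟩ - ⟨x', y'⟩ - h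
    simp only [Prod.mk.injEq] at h ⊢
    obtain ⟨hsub, hadd⟩ := h
    exact ⟨mul_left_cancel₀ ha' (by linarith), mul_left_cancel₀ hk0 (by linarith)⟩
end

section
/- Let a, b be positive integers such that a·b is not a perfect square, and let c be a nonzero integer. If the equation a·x² − b·y² + c = 0 has at least one integer solution (x, y), then it has infinitely many integer solutions; that is, the set {(x, y) ∈ ℤ × ℤ : a·x² − b·y² + c = 0} is infinite. -/
/-- Composing a solution of `a * x ^ 2 - b * y ^ 2 + c = 0` with a solution of the Pell equation
`u ^ 2 - a * b * v ^ 2 = 1` gives another solution. -/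
theorem quadratic_solution_mul_pell {a b c x y u v : ℤ} (h : a * x ^ 2 - b * y ^ 2 + c = 0)
    (huv : u ^ 2 - a * b * v ^ 2 = 1) :
    a * (x * u + b * v * y) ^ 2 - b * (y * u + a * v * x) ^ 2 + c = 0 := by
  linear_combination h + (a * x ^ 2 - b * y ^ 2) * huv

theorem stmt_6 (a b : ℕ) (ha : 0 < a) (hb : 0 < b)
    (hsq : ¬ ∃ k : ℕ, a * b = k ^ 2) (c : ℤ) (hc : c ≠ 0)
    (hsol : ∃ x y : ℤ, (a : ℤ) * x ^ 2 - (b : ℤ) * y ^ 2 + c = 0) :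
    {p : ℤ × ℤ | (a : ℤ) * p.1 ^ 2 - (b : ℤ) * p.2 ^ 2 + c = 0}.Infinite := by
  obtain ⟨x₀, y₀, h₀⟩ := hsol
  have hd : ¬ IsSquare ((a : ℤ) * b) := by
    rintro ⟨k, hk⟩
    refine hsq ⟨k.natAbs, ?_⟩
    zify
    rw [sq_abs, hk, sq]
  obtain ⟨s, hs, hv⟩ := Pell.Solution₁.exists_pos_of_not_isSquare (d := (a : ℤ) * b)
    (by positivity) hd
  intro hfin
  -- Among the finitely many nonnegative solutions, take one maximizing `x + y`.
  obtain ⟨⟨x, y⟩, ⟨hxy, hx, hy⟩, hmax⟩ := Set.exists_max_image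
    ({p : ℤ × ℤ | (a : ℤ) * p.1 ^ 2 - (b : ℤ) * p.2 ^ 2 + c = 0} ∩ {p | 0 ≤ p.1 ∧ 0 ≤ p.2})
    (fun p => p.1 + p.2) (hfin.inter_of_left _)
    ⟨(|x₀|, |y₀|), by simpa using h₀, abs_nonneg _, abs_nonneg _⟩
  simp only [Set.mem_ofPred_eq] at hxy hx hy
  have hpos : 0 < x + y := by
    by_contra! hle
    obtain rfl : x = 0 := by lia
    obtain rfl : y = 0 := by lia
    exact hc (by simpa using hxy)
  have hu : 0 ≤ s.x := by lia
  have hbv : 0 ≤ b * s.y * y := by positivity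
  have hav : 0 ≤ a * s.y * x := by positivity
  have hle := hmax (x * s.x + b * s.y * y, y * s.x + a * s.y * x)
    ⟨quadratic_solution_mul_pell hxy s.prop, by positivity, by positivity⟩
  simp only at hle
  nlinarith
end

section
/- Define sequences of integers (xₙ), (yₙ) by x₀ = 3, y₀ = 6, and x_{n+1} = 13·xₙ + 6·yₙ, y_{n+1} = 28·xₙ + 13·yₙ. Then for every natural number n, 14·xₙ² − 3·yₙ² − 18 = 0. -/
theorem stmt_13 (x y : ℕ → ℤ) (hx0 : x 0 = 3) (hy0 : y 0 = 6)
    (hx : ∀ n, x (n + 1) = 13 * x n + 6 * y n)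
    (hy : ∀ n, y (n + 1) = 28 * x n + 13 * y n) :
    ∀ n : ℕ, 14 * (x n) ^ 2 - 3 * (y n) ^ 2 - 18 = 0 := by
  intro n
  induction n with
  | zero => norm_num [hx0, hy0]
  | succ k ih =>
    rw [hx, hy]
    linear_combination ih
end

section
/- Let ε = 1 or ε = −1, and define sequences of integers (uₙ), (vₙ) by u₀ = 3, v₀ = 3·ε, and u_{n+1} = 15·uₙ + 28·vₙ, v_{n+1} = 8·uₙ + 15·vₙ. Then for every natural number n there exist integers xₙ and yₙ with 6·xₙ = 2·uₙ − vₙ + 3 and 2·yₙ = vₙ − 1, and these integers satisfy 9·xₙ² + 6·xₙ·yₙ − 13·yₙ² − 6·xₙ − 16·yₙ + 20 = 0. -/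
theorem stmt_17 (ε : ℤ) (hε : ε = 1 ∨ ε = -1)
    (u v : ℕ → ℤ) (hu0 : u 0 = 3) (hv0 : v 0 = 3 * ε)
    (hu : ∀ n, u (n + 1) = 15 * u n + 28 * v n)
    (hv : ∀ n, v (n + 1) = 8 * u n + 15 * v n) :
    ∀ n : ℕ, ∃ x y : ℤ, 6 * x = 2 * u n - v n + 3 ∧ 2 * y = v n - 1 ∧
      9 * x ^ 2 + 6 * x * y - 13 * y ^ 2 - 6 * x - 16 * y + 20 = 0 := by
  have invariant : ∀ n, u n % 3 = 0 ∧ v n % 6 = 3 ∧ 2 * u n ^ 2 - 7 * v n ^ 2 + 45 = 0 := by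
    intro n
    induction n with
    | zero => rcases hε with rfl | rfl <;> simp [hu0, hv0]
    | succ n ih =>
      obtain ⟨hu_mod, hv_mod, h_eq⟩ := ih
      rw [hu, hv]
      refine ⟨by omega, by omega, by linear_combination h_eq⟩
  intro n
  obtain ⟨hu_mod, hv_mod, h_eq⟩ := invariant n
  obtain ⟨x, hx⟩ : (6 : ℤ) ∣ 2 * u n - v n + 3 := by omega
  obtain ⟨y, hy⟩ : (2 : ℤ) ∣ v n - 1 := by omega
  refine ⟨x, y, hx.symm, hy.symm, ?_⟩
  have hv_eq : v n = 2 * y + 1 := by omega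
  have hu_eq : u n = 3 * x + y - 1 := by omega
  rw [hu_eq, hv_eq] at h_eq
  linarith
end

section
/- Let x, y be integers satisfying 9·x² + 6·x·y − 13·y² − 6·x − 16·y + 20 = 0 and y ≡ 1 (mod 3). Then 3 divides 33·x + 52·y + 11, and the integers x' = (33·x + 52·y + 11)/3 and y' = 12·x + 19·y + 3 satisfy 9·x'² + 6·x'·y' − 13·y'² − 6·x' − 16·y' + 20 = 0 and y' ≡ 1 (mod 3). -/
theorem stmt_18 (x y : ℤ)
    (h : 9 * x ^ 2 + 6 * x * y - 13 * y ^ 2 - 6 * x - 16 * y + 20 = 0)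
    (hy : y ≡ 1 [ZMOD 3]) :
    (3 : ℤ) ∣ 33 * x + 52 * y + 11 ∧
    (9 * ((33 * x + 52 * y + 11) / 3) ^ 2 +
      6 * ((33 * x + 52 * y + 11) / 3) * (12 * x + 19 * y + 3) -
      13 * (12 * x + 19 * y + 3) ^ 2 -
      6 * ((33 * x + 52 * y + 11) / 3) - 16 * (12 * x + 19 * y + 3) + 20 = 0) ∧
    (12 * x + 19 * y + 3) ≡ 1 [ZMOD 3] := by
  obtain ⟨k, hk⟩ := hy.symm.dvd
  obtain rfl : y = 3 * k + 1 := by linarith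
  have hx : 33 * x + 52 * (3 * k + 1) + 11 = 3 * (11 * x + 52 * k + 21) := by ring
  refine ⟨⟨_, hx⟩, ?_, ?_⟩
  · rw [hx, Int.mul_ediv_cancel_left _ three_ne_zero]
    linear_combination h
  · exact (Int.modEq_iff_dvd.mpr ⟨4 * x + 19 * k + 7, by ring⟩).symm
end

section
/- The set of integer pairs (x, y) satisfying 9·x² + 6·x·y − 13·y² − 6·x − 16·y + 20 = 0 is infinite. -/
/-- The conic contains integral points with positive ordinate and arbitrarily large abscissa: the
automorphism of `2u² - 7v²` given by the unit `449 + 120√14` acts on `(x, y)` with integral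
coefficients. -/
theorem exists_solution_natCast_lt_fst (n : ℕ) : ∃ x y : ℤ, (n : ℤ) < x ∧ 0 < y ∧
    9 * x ^ 2 + 6 * x * y - 13 * y ^ 2 - 6 * x - 16 * y + 20 = 0 := by
  induction n with
  | zero => exact ⟨1, 1, by norm_num⟩
  | succ n ih =>
    obtain ⟨x, y, hx, hy, h⟩ := ih
    refine ⟨329 * x + 520 * y + 96, 360 * x + 569 * y + 104, ?_, ?_, ?_⟩
    · push_cast
      linarith
    · linarith
    · linear_combination h

theorem stmt_19 :
    {p : ℤ × ℤ | 9 * p.1 ^ 2 + 6 * p.1 * p.2 - 13 * p.2 ^ 2 - 6 * p.1 - 16 * p.2 + 20 = 0}.Infinite := by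
  apply Set.Infinite.of_image Prod.fst
  refine Set.infinite_of_forall_exists_gt fun a => ?_
  obtain ⟨x, y, hx, -, h⟩ := exists_solution_natCast_lt_fst a.toNat
  exact ⟨x, ⟨(x, y), h, rfl⟩, a.self_le_toNat.trans_lt hx⟩
end
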